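/- arXiv:2504.09133 — 2 statements merged into one kernel-verified Lean document; each statement's English description precedes it below -/
import Mathlib

section
/- Let N be a positive integer, let P be an N×N complex orthogonal projection matrix (P² = P and P† = P), and let U be an N×N unitary matrix. If the matrix (I − P) + P U P is unitary, then UP = PU. -/
open Matrix

open scoped ComplexOrder in
/-- If the isometry `U` compresses to an isometry on the range of the orthogonal projection `P`,
then `U` leaves that range invariant. -/
theorem mul_projection_eq_of_controlled_isometry {n : Type*} [Fintype n] [DecidableEq n]
    {P U : Matrix n n ℂ} (hP2 : P * P = P) (hPadj : Pᴴ = P) (hU : Uᴴ * U = 1)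
    (hC : ((1 - P) + P * U * P)ᴴ * ((1 - P) + P * U * P) = 1) :
    U * P = P * U * P := by
  have hCP : ((1 - P) + P * U * P) * P = P * U * P := by
    rw [add_mul, sub_mul, one_mul, hP2, sub_self, zero_add, mul_assoc, hP2]
  have hPUP : (P * U * P)ᴴ * (P * U * P) = P := by
    rw [← hCP, conjTranspose_mul, mul_assoc, ← mul_assoc _ _ P, hC, one_mul, hPadj, hP2]
  have hUP : (U * P)ᴴ * (U * P) = P := by
    rw [conjTranspose_mul, mul_assoc, ← mul_assoc _ U, hU, one_mul, hPadj, hP2]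
  have hadj : (P * U * P)ᴴ = (U * P)ᴴ * P := by
    rw [mul_assoc, conjTranspose_mul, hPadj]
  have hidem : P * (P * U * P) = P * U * P := by
    rw [← mul_assoc, ← mul_assoc, hP2]
  have hleft : (U * P)ᴴ * (P * U * P) = P := by
    rw [hadj, mul_assoc, hidem] at hPUP
    exact hPUP
  have hright : (P * U * P)ᴴ * (U * P) = P := by
    rw [hadj, mul_assoc, ← mul_assoc P, hleft]
  rw [← sub_eq_zero, ← conjTranspose_mul_self_eq_zero, conjTranspose_sub, sub_mul, mul_sub,
    mul_sub, hUP, hleft, hright, hPUP, sub_self]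

/-- If `P` is an orthogonal projection, `U` is unitary, and `(I − P) + P U P` is
unitary, then `U` commutes with `P`. -/
theorem commute_of_subspace_controlled_unitary
    (N : ℕ) (hN : 0 < N) (P U : Matrix (Fin N) (Fin N) ℂ)
    (hP2 : P * P = P) (hPadj : Pᴴ = P)
    (hU : U ∈ Matrix.unitaryGroup (Fin N) ℂ)
    (hCPU : ((1 - P) + P * U * P) ∈ Matrix.unitaryGroup (Fin N) ℂ) :
    U * P = P * U := by
  have hUP : U * P = P * U * P :=
    mul_projection_eq_of_controlled_isometry hP2 hPadj
      (mem_unitaryGroup_iff'.mp hU) (mem_unitaryGroup_iff'.mp hCPU)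
  have hCadj : (1 - P) + P * Uᴴ * P = ((1 - P) + P * U * P)ᴴ := by
    simp only [conjTranspose_add, conjTranspose_sub, conjTranspose_one, conjTranspose_mul,
      hPadj, mul_assoc]
  have hUadj : Uᴴ * P = P * Uᴴ * P := by
    apply mul_projection_eq_of_controlled_isometry hP2 hPadj
    · rw [conjTranspose_conjTranspose]
      exact mem_unitaryGroup_iff.mp hU
    · rw [hCadj, conjTranspose_conjTranspose]
      exact mem_unitaryGroup_iff.mp hCPU
  have hPU : P * U = P * U * P := by
    simpa only [conjTranspose_mul, conjTranspose_conjTranspose, hPadj, mul_assoc]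
      using congrArg conjTranspose hUadj
  rw [hUP, ← hPU]
end

section
/- Let Q_1, …, Q_p be N×N complex orthogonal projection matrices that are pairwise orthogonal, i.e. Q_i Q_j = 0 for i ≠ j, and let U be any d×d complex matrix. Then the product of the corresponding controlled operators collapses to a single controlled operator: ∏_{j=1}^p [ (I_N − Q_j) ⊗ I_d + Q_j ⊗ U ] = (I_N − ∑_{j=1}^p Q_j) ⊗ I_d + (∑_{j=1}^p Q_j) ⊗ U. -/
open Matrix Kronecker

section Controlled

variable {m n R : Type*} [DecidableEq m] [DecidableEq n] [CommRing R]

/-- A controlled operator is a perturbation of the identity by `A ⊗ (U - 1)`. -/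
theorem controlled_eq_one_add (A : Matrix m m R) (U : Matrix n n R) :
    (1 - A) ⊗ₖ (1 : Matrix n n R) + A ⊗ₖ U = 1 + A ⊗ₖ (U - 1) := by
  rw [sub_eq_add_neg U, kronecker_add, sub_eq_add_neg 1 A, add_kronecker, one_kronecker_one,
    ← neg_one_smul R A, ← neg_one_smul R (1 : Matrix n n R), smul_kronecker, kronecker_smul]
  abel

/-- If every matrix in a list annihilates the later ones, the perturbations of the identity
by `A ⊗ V` multiply to the perturbation by the sum. -/
theorem prod_one_add_kronecker [Fintype m] [Fintype n] (V : Matrix n n R) (l : List (Matrix m m R))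
    (hl : l.Pairwise fun A B => A * B = 0) :
    (l.map fun A => 1 + A ⊗ₖ V).prod = 1 + l.sum ⊗ₖ V := by
  induction l with
  | nil => simp
  | cons A l ih =>
    obtain ⟨hA, hl⟩ := List.pairwise_cons.mp hl
    have hsum : A * l.sum = 0 := by
      rw [← AddMonoidHom.coe_mulLeft, map_list_sum]
      exact List.sum_eq_zero (by simpa using hA)
    rw [List.map_cons, List.prod_cons, ih hl, List.sum_cons, add_kronecker, add_mul, mul_add,
      mul_add, ← mul_kronecker_mul, hsum, zero_kronecker]
    simp only [one_mul, mul_one, add_zero]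
    abel

end Controlled

/-- For pairwise orthogonal projections `Q_1, …, Q_p` and any matrix `U`, the
product of the controlled operators `(I − Q_j) ⊗ I + Q_j ⊗ U` collapses to the
single controlled operator `(I − ∑ Q_j) ⊗ I + (∑ Q_j) ⊗ U`. -/
theorem prod_controlled_of_orthogonal (N d p : ℕ)
    (Q : Fin p → Matrix (Fin N) (Fin N) ℂ)
    (hproj : ∀ j, Q j * Q j = Q j ∧ (Q j)ᴴ = Q j)
    (horth : ∀ i j, i ≠ j → Q i * Q j = 0)
    (U : Matrix (Fin d) (Fin d) ℂ) :
    ((List.finRange p).map (fun j =>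
        (1 - Q j) ⊗ₖ (1 : Matrix (Fin d) (Fin d) ℂ) + Q j ⊗ₖ U)).prod =
      (1 - ∑ j, Q j) ⊗ₖ (1 : Matrix (Fin d) (Fin d) ℂ) + (∑ j, Q j) ⊗ₖ U := by
  have hpair : ((List.finRange p).map Q).Pairwise fun A B => A * B = 0 :=
    List.pairwise_map.mpr ((List.nodup_finRange p).imp fun h => horth _ _ h)
  simp only [controlled_eq_one_add]
  have hprod := prod_one_add_kronecker (U - 1) _ hpair
  rw [List.map_map] at hprod
  rw [← List.ofFn_eq_map (f := Q), List.sum_ofFn] at hprod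
  exact hprod
end
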